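/- arXiv:0908.4401 — 3 statements merged into one kernel-verified Lean document; each statement's English description precedes it below -/
import Mathlib

section
/- (Deterministic generalized fractional Hamilton–Pontryagin principle; Theorem 2 with γ = 0.) Let L : ℝ × ℝⁿ × ℝⁿ → ℝ be of class C², let α : ℝ → ℝ be differentiable and ρ ∈ ℝ, fix an observer time t ∈ ℝ, and let a < b with t ∉ [a,b] and α(s−t) > 0 for all s ∈ [a,b]. Let (q,v,p) : [a,b] → ℝⁿ × ℝⁿ × ℝⁿ be a curve with q, p of class C¹ and v continuous. Then q'(s) = v(s), p'(s) = ∇_q L(s,q(s),v(s)) − h(s,t)·p(s), and p(s) = ∇_v L(s,q(s),v(s)) hold for all s ∈ [a,b] if and only if for every variation (δq, δv, δp) with δq of class C¹, δv, δp continuous, and δq(a) = δq(b) = 0, the function ε ↦ A^α(q+εδq, v+εδv, p+εδp) is differentiable at ε = 0 with derivative zero, where A^α(q,v,p) = ∫_a^b [ L(s,q(s),v(s)) + ⟨p(s), q'(s) − v(s)⟩ ] g_t(s) ds. -/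
open RealInnerProductSpace

/-- The generalized fractional weight
`g_t(s) = (1/Γ(α(s−t))) · |t−s|^{α(s−t)−1} · e^{ρ(s−t)}`. -/
noncomputable def gwt (t ρ : ℝ) (α : ℝ → ℝ) (s : ℝ) : ℝ :=
  (1 / Real.Gamma (α (s - t))) * |t - s| ^ (α (s - t) - 1) * Real.exp (ρ * (s - t))

/-- The logarithmic-derivative function
`h(s,t) = α'(s−t)·ln|t−s| + (α(s−t)−1)/(s−t) + ρ − (Γ'(α(s−t))/Γ(α(s−t)))·α'(s−t)`. -/
noncomputable def hwt (t ρ : ℝ) (α : ℝ → ℝ) (s : ℝ) : ℝ :=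
  deriv α (s - t) * Real.log |t - s| + (α (s - t) - 1) / (s - t) + ρ
    - (deriv Real.Gamma (α (s - t)) / Real.Gamma (α (s - t))) * deriv α (s - t)

theorem gwt_deriv (t ρ : ℝ) (α : ℝ → ℝ) (hα : Differentiable ℝ α) (s : ℝ) (hs : s ≠ t)
    (hpos : 0 < α (s - t)) : HasDerivAt (gwt t ρ α) (hwt t ρ α s * gwt t ρ α s) s := by
  have hts : t - s ≠ 0 := fun h => hs (by linarith)
  have hst : s - t ≠ 0 := fun h => hs (by linarith)
  have h1 : HasDerivAt (fun x => x - t) 1 s := (hasDerivAt_id s).sub_const t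
  have h2 : HasDerivAt (fun x => t - x) (-1) s := (hasDerivAt_id s).const_sub t
  have hA : HasDerivAt (fun x => α (x - t)) (deriv α (s - t)) s := by
    have := HasDerivAt.comp (h₂ := α) s (hα (s - t)).hasDerivAt h1
    simpa only [Function.comp_def, mul_one] using this
  have hGd : DifferentiableAt ℝ Real.Gamma (α (s - t)) :=
    Real.differentiableAt_Gamma (fun m h => by
      have : (0 : ℝ) ≤ m := Nat.cast_nonneg m
      linarith)
  have hG : HasDerivAt (fun x => Real.Gamma (α (x - t)))
      (deriv Real.Gamma (α (s - t)) * deriv α (s - t)) s :=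
    HasDerivAt.comp (h₂ := Real.Gamma) s hGd.hasDerivAt hA
  have hGp := Real.Gamma_pos_of_pos hpos
  have hl : HasDerivAt (fun x => Real.log (t - x)) (-1 / (t - s)) s := h2.log hts
  have hE := (hl.mul (hA.sub_const 1)).exp
  have hR := (h1.const_mul ρ).exp
  have key := ((hG.inv hGp.ne').mul hE).mul hR
  have hev : gwt t ρ α =ᶠ[nhds s] (((fun x => Real.Gamma (α (x - t)))⁻¹ * fun x => Real.exp (((fun x => Real.log (t - x)) * fun x => α (x - t) - 1) x)) * fun x => Real.exp (ρ * (x - t))) := by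
    filter_upwards [isOpen_ne.mem_nhds hs] with x hx
    have hx' : t - x ≠ 0 := fun h => hx (by linarith)
    simp only [gwt, Pi.mul_apply, Pi.inv_apply]
    rw [Real.rpow_def_of_pos (abs_pos.2 hx'), Real.log_abs, one_div]
  have k2 := key.congr_of_eventuallyEq hev
  refine k2.congr_deriv ?_
  simp only [gwt, hwt, Pi.mul_apply, Pi.inv_apply]
  rw [Real.rpow_def_of_pos (abs_pos.2 hts), Real.log_abs]
  have e : (α (s - t) - 1) / (s - t) = (-1 / (t - s)) * (α (s - t) - 1) := by
    field_simp
    ring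
  rw [e]
  field_simp
  ring

theorem gwt_pos (t ρ : ℝ) (α : ℝ → ℝ) (s : ℝ) (hs : s ≠ t)
    (hpos : 0 < α (s - t)) : 0 < gwt t ρ α s := by
  have hts : t - s ≠ 0 := fun h => hs (by linarith)
  have hGp := Real.Gamma_pos_of_pos hpos
  have := abs_pos.2 hts
  unfold gwt
  positivity

theorem param_deriv (a b : ℝ) (F F' : ℝ → ℝ → ℝ)
    (hd : ∀ e s, HasDerivAt (fun x => F x s) (F' e s) e)
    (hF : Continuous (Function.uncurry F)) (hF' : Continuous (Function.uncurry F')) :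
    HasDerivAt (fun e => ∫ s in a..b, F e s) (∫ s in a..b, F' 0 s) 0 := by
  have hc : IsCompact (Metric.closedBall (0:ℝ) 1 ×ˢ Set.uIcc a b) :=
    (isCompact_closedBall _ _).prod isCompact_uIcc
  obtain ⟨C, hC⟩ := hc.exists_bound_of_continuousOn hF'.continuousOn
  have cF : ∀ e, Continuous (F e) := fun e => hF.comp (by fun_prop : Continuous fun s : ℝ => (e, s))
  have cF' : ∀ e, Continuous (F' e) := fun e => hF'.comp (by fun_prop : Continuous fun s : ℝ => (e, s))
  refine (intervalIntegral.hasDerivAt_integral_of_dominated_loc_of_deriv_le (bound := fun _ => C)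
    (Metric.ball_mem_nhds 0 one_pos) ?_ ?_ ?_ ?_ ?_ ?_).2
  · exact Filter.Eventually.of_forall fun e => (cF e).aestronglyMeasurable
  · exact (cF 0).intervalIntegrable _ _
  · exact (cF' 0).aestronglyMeasurable
  · exact Filter.Eventually.of_forall fun s hs e he =>
      hC (e, s) ⟨Metric.ball_subset_closedBall he, Set.uIoc_subset_uIcc hs⟩
  · exact intervalIntegrable_const
  · exact Filter.Eventually.of_forall fun s hs e he => hd e s

section
variable {E : Type*} [NormedAddCommGroup E] [InnerProductSpace ℝ E] [CompleteSpace E]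

theorem ext_cont {X : Type*} [TopologicalSpace X] {a b : ℝ} (hab : a ≤ b) {f : ℝ → X} (hf : ContinuousOn f (Set.Icc a b)) :
    ∃ g : ℝ → X, Continuous g ∧ ∀ s ∈ Set.Icc a b, f s = g s :=
  ⟨Set.IccExtend hab ((Set.Icc a b).domRestrict f), (continuousOn_iff_continuous_domRestrict.1 hf).Icc_extend',
    fun s hs => by rw [Set.IccExtend_of_mem _ _ hs]; rfl⟩

theorem inner_grad {f : E → ℝ} (x y : E) : ⟪gradient f x, y⟫ = fderiv ℝ f x y := by
  rw [gradient, InnerProductSpace.toDual_symm_apply]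

theorem gradq_eq {L : ℝ → E → E → ℝ}
    (hL : ContDiff ℝ 2 (fun x : ℝ × E × E => L x.1 x.2.1 x.2.2)) (s : ℝ) (x w : E) :
    gradient (fun y => L s y w) x = (InnerProductSpace.toDual ℝ E).symm
      ((fderiv ℝ (fun x : ℝ × E × E => L x.1 x.2.1 x.2.2) (s, x, w)).comp
        ((ContinuousLinearMap.inr ℝ ℝ (E × E)).comp (ContinuousLinearMap.inl ℝ E E))) := by
  rw [gradient]
  congr 1
  have h := ((hL.differentiable (by norm_num)) (s, x, w)).hasFDerivAt
  have h2 : HasFDerivAt (fun y : E => (s, y, w))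
      ((ContinuousLinearMap.inr ℝ ℝ (E × E)).comp (ContinuousLinearMap.inl ℝ E E)) x :=
    (hasFDerivAt_prodMk_right s (x, w)).comp x (hasFDerivAt_prodMk_left x w)
  exact (HasFDerivAt.comp (g := fun x : ℝ × E × E => L x.1 x.2.1 x.2.2) x h h2).fderiv

theorem gradv_eq {L : ℝ → E → E → ℝ}
    (hL : ContDiff ℝ 2 (fun x : ℝ × E × E => L x.1 x.2.1 x.2.2)) (s : ℝ) (x w : E) :
    gradient (fun y => L s x y) w = (InnerProductSpace.toDual ℝ E).symm
      ((fderiv ℝ (fun x : ℝ × E × E => L x.1 x.2.1 x.2.2) (s, x, w)).comp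
        ((ContinuousLinearMap.inr ℝ ℝ (E × E)).comp (ContinuousLinearMap.inr ℝ E E))) := by
  rw [gradient]
  congr 1
  have h := ((hL.differentiable (by norm_num)) (s, x, w)).hasFDerivAt
  have h2 : HasFDerivAt (fun y : E => (s, x, y))
      ((ContinuousLinearMap.inr ℝ ℝ (E × E)).comp (ContinuousLinearMap.inr ℝ E E)) w :=
    (hasFDerivAt_prodMk_right s (x, w)).comp w (hasFDerivAt_prodMk_right x w)
  exact (HasFDerivAt.comp (g := fun x : ℝ × E × E => L x.1 x.2.1 x.2.2) w h h2).fderiv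

theorem cont_fd {L : ℝ → E → E → ℝ}
    (hL : ContDiff ℝ 2 (fun x : ℝ × E × E => L x.1 x.2.1 x.2.2)) :
    Continuous (fderiv ℝ (fun x : ℝ × E × E => L x.1 x.2.1 x.2.2)) :=
  hL.continuous_fderiv (by norm_num)

theorem gradq_cont {L : ℝ → E → E → ℝ}
    (hL : ContDiff ℝ 2 (fun x : ℝ × E × E => L x.1 x.2.1 x.2.2)) :
    Continuous (fun z : ℝ × E × E => gradient (fun y => L z.1 y z.2.2) z.2.1) := by
  simp_rw [gradq_eq hL]
  exact (InnerProductSpace.toDual ℝ E).symm.continuous.comp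
    ((cont_fd hL).clm_comp continuous_const)

theorem gradv_cont {L : ℝ → E → E → ℝ}
    (hL : ContDiff ℝ 2 (fun x : ℝ × E × E => L x.1 x.2.1 x.2.2)) :
    Continuous (fun z : ℝ × E × E => gradient (fun y => L z.1 z.2.1 y) z.2.2) := by
  simp_rw [gradv_eq hL]
  exact (InnerProductSpace.toDual ℝ E).symm.continuous.comp
    ((cont_fd hL).clm_comp continuous_const)

theorem fd_split {L : ℝ → E → E → ℝ}
    (hL : ContDiff ℝ 2 (fun x : ℝ × E × E => L x.1 x.2.1 x.2.2)) (s : ℝ) (x w y z : E) :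
    fderiv ℝ (fun x : ℝ × E × E => L x.1 x.2.1 x.2.2) (s, x, w) (0, y, z) =
      ⟪gradient (fun y => L s y w) x, y⟫ + ⟪gradient (fun y => L s x y) w, z⟫ := by
  rw [gradq_eq hL, gradv_eq hL, InnerProductSpace.toDual_symm_apply,
    InnerProductSpace.toDual_symm_apply]
  simp only [ContinuousLinearMap.comp_apply, ContinuousLinearMap.inl_apply,
    ContinuousLinearMap.inr_apply]
  rw [← map_add]
  simp

theorem firstVar0 (a b : ℝ) {L : ℝ → E → E → ℝ}
    (hL : ContDiff ℝ 2 (fun x : ℝ × E × E => L x.1 x.2.1 x.2.2))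
    {q v p q' dq dv dp dq' : ℝ → E} {g : ℝ → ℝ}
    (cq : Continuous q) (cv : Continuous v) (cp : Continuous p) (cq' : Continuous q')
    (cdq : Continuous dq) (cdv : Continuous dv) (cdp : Continuous dp) (cdq' : Continuous dq')
    (cg : Continuous g) :
    HasDerivAt (fun ε : ℝ => ∫ s in a..b,
            (L s (q s + ε • dq s) (v s + ε • dv s) +
              ⟪p s + ε • dp s, (q' s + ε • dq' s) - (v s + ε • dv s)⟫) * g s)
      (∫ s in a..b, (⟪gradient (fun y => L s y (v s)) (q s), dq s⟫
        + ⟪gradient (fun y => L s (q s) y) (v s) - p s, dv s⟫ + ⟪dp s, q' s - v s⟫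
        + ⟪p s, dq' s⟫) * g s) 0 := by
  have cL := hL.continuous
  have := cont_fd hL
  convert param_deriv a b (fun ε s => (L s (q s + ε • dq s) (v s + ε • dv s) +
              ⟪p s + ε • dp s, (q' s + ε • dq' s) - (v s + ε • dv s)⟫) * g s)
    (fun ε s => (fderiv ℝ (fun x : ℝ × E × E => L x.1 x.2.1 x.2.2)
      (s, q s + ε • dq s, v s + ε • dv s) (0, dq s, dv s) +
       (⟪p s + ε • dp s, dq' s - dv s⟫ + 
         ⟪dp s, (q' s + ε • dq' s) - (v s + ε • dv s)⟫)) * g s) ?_ ?_ ?_ using 1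
  · refine intervalIntegral.integral_congr fun s _ => ?_
    simp only [zero_smul, add_zero]
    rw [fd_split hL]
    simp only [inner_sub_left, inner_sub_right]
    ring
  · intro e s
    have l : ∀ x y : E, HasDerivAt (fun ε : ℝ => x + ε • y) y e := fun x y => by
      simpa using ((hasDerivAt_id e).smul_const y).const_add x
    have h1 : HasDerivAt (fun ε : ℝ => (s, q s + ε • dq s, v s + ε • dv s)) (0, dq s, dv s) e :=
      (hasDerivAt_const e s).prodMk ((l _ _).prodMk (l _ _))
    have h2 := ((hL.differentiable (by norm_num))
      (s, q s + e • dq s, v s + e • dv s)).hasFDerivAt.comp_hasDerivAt e h1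
    exact (h2.add ((l (p s) (dp s)).inner ℝ ((l (q' s) (dq' s)).sub (l (v s) (dv s))))).mul_const _
  · have : Continuous fun z : ℝ × ℝ => L z.2 (q z.2 + z.1 • dq z.2) (v z.2 + z.1 • dv z.2) :=
      cL.comp (f := fun z : ℝ × ℝ => (z.2, q z.2 + z.1 • dq z.2, v z.2 + z.1 • dv z.2)) (by fun_prop)
    simp only [Function.uncurry_def]
    fun_prop
  · simp only [Function.uncurry_def]
    fun_prop

theorem firstVar {a b : ℝ} (hab : a ≤ b) {L : ℝ → E → E → ℝ}
    (hL : ContDiff ℝ 2 (fun x : ℝ × E × E => L x.1 x.2.1 x.2.2))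
    {q v p q' dq dv dp dq' : ℝ → E} {g : ℝ → ℝ}
    (cq : ContinuousOn q (Set.Icc a b)) (cv : ContinuousOn v (Set.Icc a b))
    (cp : ContinuousOn p (Set.Icc a b)) (cq' : ContinuousOn q' (Set.Icc a b))
    (cdq : ContinuousOn dq (Set.Icc a b)) (cdv : ContinuousOn dv (Set.Icc a b))
    (cdp : ContinuousOn dp (Set.Icc a b)) (cdq' : ContinuousOn dq' (Set.Icc a b))
    (cg : ContinuousOn g (Set.Icc a b)) :
    HasDerivAt (fun ε : ℝ => ∫ s in a..b,
            (L s (q s + ε • dq s) (v s + ε • dv s) +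
              ⟪p s + ε • dp s, (q' s + ε • dq' s) - (v s + ε • dv s)⟫) * g s)
      (∫ s in a..b, (⟪gradient (fun y => L s y (v s)) (q s), dq s⟫
        + ⟪gradient (fun y => L s (q s) y) (v s) - p s, dv s⟫ + ⟪dp s, q' s - v s⟫
        + ⟪p s, dq' s⟫) * g s) 0 := by
  obtain ⟨q1, c1, e1⟩ := ext_cont hab cq
  obtain ⟨q2, c2, e2⟩ := ext_cont hab cv
  obtain ⟨q3, c3, e3⟩ := ext_cont hab cp
  obtain ⟨q4, c4, e4⟩ := ext_cont hab cq'
  obtain ⟨q5, c5, e5⟩ := ext_cont hab cdq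
  obtain ⟨q6, c6, e6⟩ := ext_cont hab cdv
  obtain ⟨q7, c7, e7⟩ := ext_cont hab cdp
  obtain ⟨q8, c8, e8⟩ := ext_cont hab cdq'
  obtain ⟨q9, c9, e9⟩ := ext_cont hab cg
  convert firstVar0 a b hL c1 c2 c3 c4 c5 c6 c7 c8 c9 using 1
  · funext ε
    refine intervalIntegral.integral_congr fun s hs => ?_
    rw [Set.uIcc_of_le hab] at hs
    simp only [e1 s hs, e2 s hs, e3 s hs, e4 s hs, e5 s hs, e6 s hs, e7 s hs, e8 s hs, e9 s hs]
  · refine intervalIntegral.integral_congr fun s hs => ?_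
    rw [Set.uIcc_of_le hab] at hs
    simp only [e1 s hs, e2 s hs, e3 s hs, e4 s hs, e5 s hs, e6 s hs, e7 s hs, e8 s hs, e9 s hs]

theorem zero_of_int {a b : ℝ} (hab : a < b) {f : ℝ → E} {g : ℝ → ℝ}
    (cf : ContinuousOn f (Set.Icc a b)) (cg : ContinuousOn g (Set.Icc a b))
    (hg : ∀ s ∈ Set.Icc a b, 0 < g s) (h : ∫ s in a..b, ⟪f s, f s⟫ * g s = 0) :
    ∀ s ∈ Set.Icc a b, f s = 0 := by
  intro s hs
  by_contra hne
  have : 0 < ∫ s in a..b, ⟪f s, f s⟫ * g s := by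
    refine intervalIntegral.integral_pos hab ((cf.inner cf).mul cg) (fun x hx => ?_) ⟨s, hs, ?_⟩
    · exact mul_nonneg real_inner_self_nonneg (hg x (Set.Ioc_subset_Icc_self hx)).le
    · exact mul_pos (real_inner_self_pos.2 hne) (hg s hs)
  linarith

theorem dbr {a b : ℝ} (hab : a < b) {P F : ℝ → E} (cP : ContinuousOn P (Set.Icc a b))
    (cF : ContinuousOn F (Set.Icc a b))
    (h : ∀ dq dq' : ℝ → E, ContDiff ℝ 1 dq → (∀ s, HasDerivAt dq (dq' s) s) →
      Continuous dq' → dq a = 0 → dq b = 0 → ∫ s in a..b, (⟪F s, dq s⟫ + ⟪P s, dq' s⟫) = 0) :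
    ∀ s ∈ Set.Icc a b, HasDerivWithinAt P (F s) (Set.Icc a b) s := by
  obtain ⟨P1, cP1, eP⟩ := ext_cont hab.le cP
  obtain ⟨F1, cF1, eF⟩ := ext_cont hab.le cF
  set G : ℝ → E := fun s => ∫ x in a..s, F1 x with hG
  have dG : ∀ s, HasDerivAt G (F1 s) s := fun s =>
    intervalIntegral.integral_hasDerivAt_right (cF1.intervalIntegrable _ _)
      (cF1.stronglyMeasurableAtFilter _ _) cF1.continuousAt
  have cG : Continuous G := continuous_iff_continuousAt.2 fun s => (dG s).continuousAt
  set c : E := (b - a)⁻¹ • ∫ x in a..b, (P1 x - G x) with hc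
  set u : ℝ → E := fun s => P1 s - G s - c with hu
  have cu : Continuous u := by fun_prop
  have iu : ∫ x in a..b, u x = 0 := by
    have e := intervalIntegral.integral_sub (μ := MeasureTheory.volume) (a := a) (b := b)
      (f := fun x => P1 x - G x) (g := fun _ => c)
      (Continuous.intervalIntegrable (by fun_prop) _ _) intervalIntegrable_const
    simp only [hu]
    rw [e, intervalIntegral.integral_const, hc, smul_smul,
      mul_inv_cancel₀ (by linarith), one_smul, sub_self]
  set U : ℝ → E := fun s => ∫ x in a..s, u x with hU
  have dU : ∀ s, HasDerivAt U (u s) s := fun s =>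
    intervalIntegral.integral_hasDerivAt_right (cu.intervalIntegrable _ _)
      (cu.stronglyMeasurableAtFilter _ _) cu.continuousAt
  have cU : Continuous U := continuous_iff_continuousAt.2 fun s => (dU s).continuousAt
  have cdU : ContDiff ℝ 1 U := by
    rw [contDiff_one_iff_deriv]
    refine ⟨fun s => (dU s).differentiableAt, ?_⟩
    have : deriv U = u := funext fun s => (dU s).deriv
    rwa [this]
  have Ua : U a = 0 := by simp [hU]
  have Ub : U b = 0 := iu
  have k1 := h U u cdU dU cu Ua Ub
  have k1' : ∫ s in a..b, (⟪F1 s, U s⟫ + ⟪P1 s, u s⟫) = 0 := by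
    rw [← k1]
    refine intervalIntegral.integral_congr fun s hs => ?_
    rw [Set.uIcc_of_le hab.le] at hs
    simp only [eP s hs, eF s hs]
  have k2 : ∫ s in a..b, (⟪G s + c, u s⟫ + ⟪F1 s, U s⟫) = 0 := by
    rw [intervalIntegral.integral_eq_sub_of_hasDerivAt
      (f := fun s => ⟪G s + c, U s⟫) (fun s _ => ((dG s).add_const c).inner ℝ (dU s))
      (Continuous.intervalIntegrable (by fun_prop) _ _)]
    simp [Ua, Ub]
  have k3 : ∫ s in a..b, ⟪u s, u s⟫ * 1 = 0 := by
    have := intervalIntegral.integral_sub (μ := MeasureTheory.volume) (a := a) (b := b)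
      (f := fun s => (⟪F1 s, U s⟫ + ⟪P1 s, u s⟫)) (g := fun s => (⟪G s + c, u s⟫ + ⟪F1 s, U s⟫))
      (Continuous.intervalIntegrable (by fun_prop) _ _)
      (Continuous.intervalIntegrable (by fun_prop) _ _)
    rw [k1', k2, sub_zero] at this
    rw [← this]
    refine intervalIntegral.integral_congr fun s hs => ?_
    have : u s = P1 s - (G s + c) := by simp only [hu]; abel
    nth_rewrite 1 [this]
    simp only [inner_sub_left]
    ring
  have uz := zero_of_int hab cu.continuousOn continuousOn_const (fun _ _ => one_pos) k3
  intro s hs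
  have hP : ∀ x ∈ Set.Icc a b, P x = G x + c := fun x hx => by
    have := uz x hx
    simp only [hu] at this
    rw [eP x hx, ← sub_eq_zero, ← this]
    abel
  rw [eF s hs]
  exact ((dG s).add_const c).hasDerivWithinAt.congr hP (hP s hs)

theorem cont_of_deriv {a b : ℝ} (hab : a < b) {f f' : ℝ → E} (hf : ContDiffOn ℝ 1 f (Set.Icc a b))
    (h : ∀ s ∈ Set.Icc a b, HasDerivWithinAt f (f' s) (Set.Icc a b) s) :
    ContinuousOn f' (Set.Icc a b) :=
  (hf.continuousOn_derivWithin (uniqueDiffOn_Icc hab) le_rfl).congr fun s hs =>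
    ((h s hs).derivWithin (uniqueDiffOn_Icc hab s hs)).symm
end

/-- Deterministic generalized fractional Hamilton–Pontryagin principle (Theorem 2 with
`γ = 0`): the generalized fractional HP equations hold on `[a,b]` iff the generalized
fractional HP action `A^α` is critical, i.e. for every admissible variation with
`δq(a) = δq(b) = 0` the map `ε ↦ A^α(q+εδq, v+εδv, p+εδp)` has derivative `0` at `ε = 0`. -/
theorem statement5 (n : ℕ) (a b : ℝ) (hab : a < b)
    (α : ℝ → ℝ) (hα : Differentiable ℝ α) (ρ t : ℝ)
    (ht : t ∉ Set.Icc a b) (hαpos : ∀ s ∈ Set.Icc a b, 0 < α (s - t))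
    (L : ℝ → EuclideanSpace ℝ (Fin n) → EuclideanSpace ℝ (Fin n) → ℝ)
    (hL : ContDiff ℝ 2 (fun x : ℝ × EuclideanSpace ℝ (Fin n) × EuclideanSpace ℝ (Fin n) =>
      L x.1 x.2.1 x.2.2))
    (q v p q' p' : ℝ → EuclideanSpace ℝ (Fin n))
    (hq : ContDiffOn ℝ 1 q (Set.Icc a b))
    (hp : ContDiffOn ℝ 1 p (Set.Icc a b))
    (hv : ContinuousOn v (Set.Icc a b))
    (hq' : ∀ s ∈ Set.Icc a b, HasDerivWithinAt q (q' s) (Set.Icc a b) s)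
    (hp' : ∀ s ∈ Set.Icc a b, HasDerivWithinAt p (p' s) (Set.Icc a b) s) :
    (∀ s ∈ Set.Icc a b,
        q' s = v s ∧
        p' s = gradient (fun x => L s x (v s)) (q s) - hwt t ρ α s • p s ∧
        p s = gradient (fun w => L s (q s) w) (v s))
      ↔
    (∀ δq δv δp δq' : ℝ → EuclideanSpace ℝ (Fin n),
        ContDiffOn ℝ 1 δq (Set.Icc a b) →
        ContinuousOn δv (Set.Icc a b) →
        ContinuousOn δp (Set.Icc a b) →
        (∀ s ∈ Set.Icc a b, HasDerivWithinAt δq (δq' s) (Set.Icc a b) s) →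
        δq a = 0 → δq b = 0 →
        HasDerivAt (fun ε : ℝ =>
          ∫ s in a..b,
            (L s (q s + ε • δq s) (v s + ε • δv s) +
              ⟪p s + ε • δp s, (q' s + ε • δq' s) - (v s + ε • δv s)⟫) * gwt t ρ α s) 0 0) := by
  have hne : ∀ s ∈ Set.Icc a b, s ≠ t := fun s hs h => ht (h ▸ hs)
  have hg : ∀ s ∈ Set.Icc a b, HasDerivAt (gwt t ρ α) (hwt t ρ α s * gwt t ρ α s) s :=
    fun s hs => gwt_deriv t ρ α hα s (hne s hs) (hαpos s hs)
  have gpos : ∀ s ∈ Set.Icc a b, 0 < gwt t ρ α s :=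
    fun s hs => gwt_pos t ρ α s (hne s hs) (hαpos s hs)
  have cg : ContinuousOn (gwt t ρ α) (Set.Icc a b) :=
    fun s hs => (hg s hs).continuousAt.continuousWithinAt
  have cq := hq.continuousOn
  have cp := hp.continuousOn
  have cq' := cont_of_deriv hab hq hq'
  have cz : ContinuousOn (fun s => (s, q s, v s)) (Set.Icc a b) :=
    continuousOn_id.prodMk (cq.prodMk hv)
  have cgq : ContinuousOn (fun s => gradient (fun x => L s x (v s)) (q s)) (Set.Icc a b) :=
    (gradq_cont hL).comp_continuousOn cz
  have cgv : ContinuousOn (fun s => gradient (fun x => L s (q s) x) (v s)) (Set.Icc a b) :=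
    (gradv_cont hL).comp_continuousOn cz
  have hgp : ∀ s ∈ Set.Icc a b, HasDerivWithinAt (fun s => gwt t ρ α s • p s)
      (gwt t ρ α s • p' s + (hwt t ρ α s * gwt t ρ α s) • p s) (Set.Icc a b) s :=
    fun s hs => (hg s hs).hasDerivWithinAt.smul (hp' s hs)
  have cgp : ContinuousOn (fun s => gwt t ρ α s • p s) (Set.Icc a b) := cg.smul cp
  have cgF : ContinuousOn (fun s => gwt t ρ α s • gradient (fun x => L s x (v s)) (q s))
    (Set.Icc a b) := cg.smul cgq
  constructor
  · intro H δq δv δp δq' h1 h2 h3 h4 ha hb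
    have cdq' := cont_of_deriv hab h1 h4
    have key := firstVar hab.le hL cq hv cp cq' h1.continuousOn h2 h3 cdq' cg
    convert key using 1
    symm
    have cI : ContinuousOn (fun s => ⟪gwt t ρ α s • p s, δq' s⟫ +
        ⟪gwt t ρ α s • gradient (fun x => L s x (v s)) (q s), δq s⟫) (Set.Icc a b) :=
      (cgp.inner cdq').add (cgF.inner h1.continuousOn)
    have e := intervalIntegral.integral_eq_sub_of_hasDerivAt_of_le hab.le
      (f := fun s => ⟪gwt t ρ α s • p s, δq s⟫)
      (cgp.inner h1.continuousOn) (fun s hs => by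
        have hs' := Set.Ioo_subset_Icc_self hs
        have := (hgp s hs').inner ℝ (h4 s hs')
        have e : gwt t ρ α s • p' s + (hwt t ρ α s * gwt t ρ α s) • p s =
            gwt t ρ α s • gradient (fun x => L s x (v s)) (q s) := by
          rw [(H s hs').2.1, smul_sub, smul_smul, mul_comm (hwt t ρ α s)]
          abel
        rw [e] at this
        exact this.hasDerivAt (Icc_mem_nhds hs.1 hs.2))
      (ContinuousOn.intervalIntegrable_of_Icc hab.le cI)
    simp only [ha, hb, inner_zero_right, sub_zero] at e
    rw [← e]
    refine intervalIntegral.integral_congr fun s hs => ?_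
    rw [Set.uIcc_of_le hab.le] at hs
    obtain ⟨e1, -, e3⟩ := H s hs
    simp only [e1, ← e3, sub_self, inner_zero_left, inner_zero_right, real_inner_smul_left]
    ring
  · intro H
    have D : ∀ δq δv δp δq' : ℝ → EuclideanSpace ℝ (Fin n),
        ContDiffOn ℝ 1 δq (Set.Icc a b) →
        ContinuousOn δv (Set.Icc a b) →
        ContinuousOn δp (Set.Icc a b) →
        (∀ s ∈ Set.Icc a b, HasDerivWithinAt δq (δq' s) (Set.Icc a b) s) →
        δq a = 0 → δq b = 0 → ∫ s in a..b, (⟪gradient (fun y => L s y (v s)) (q s), δq s⟫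
        + ⟪gradient (fun y => L s (q s) y) (v s) - p s, δv s⟫ + ⟪δp s, q' s - v s⟫
        + ⟪p s, δq' s⟫) * gwt t ρ α s = 0 := by
      intro δq δv δp δq' h1 h2 h3 h4 ha hb
      exact (firstVar hab.le hL cq hv cp cq' h1.continuousOn h2 h3 (cont_of_deriv hab h1 h4)
        cg).unique (H δq δv δp δq' h1 h2 h3 h4 ha hb)
    have A1 : ∀ s ∈ Set.Icc a b, q' s - v s = 0 := by
      refine zero_of_int hab (cq'.sub hv) cg gpos ?_
      have := D (fun _ => 0) (fun _ => 0) (fun s => q' s - v s) (fun _ => 0) contDiffOn_const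
        continuousOn_const (cq'.sub hv) (fun s _ => hasDerivWithinAt_const _ _ _) rfl rfl
      simpa using this
    have A2 : ∀ s ∈ Set.Icc a b, gradient (fun y => L s (q s) y) (v s) - p s = 0 := by
      refine zero_of_int hab (cgv.sub cp) cg gpos ?_
      have := D (fun _ => 0) (fun s => gradient (fun y => L s (q s) y) (v s) - p s)
        (fun _ => 0) (fun _ => 0) contDiffOn_const
        (cgv.sub cp) continuousOn_const (fun s _ => hasDerivWithinAt_const _ _ _) rfl rfl
      simpa using this
    have A3 := dbr hab cgp cgF (fun dq dq' h1 h2 h3 ha hb => by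
      have := D dq (fun _ => 0) (fun _ => 0) dq' h1.contDiffOn continuousOn_const
        continuousOn_const (fun s _ => (h2 s).hasDerivWithinAt) ha hb
      rw [← this]
      refine intervalIntegral.integral_congr fun s hs => ?_
      simp only [inner_zero_left, inner_zero_right, real_inner_smul_left]
      ring)
    intro s hs
    refine ⟨sub_eq_zero.1 (A1 s hs), ?_, (sub_eq_zero.1 (A2 s hs)).symm⟩
    have e := (uniqueDiffOn_Icc hab s hs).eq_deriv _ (A3 s hs) (hgp s hs)
    rw [mul_comm, mul_smul, ← smul_add] at e
    have e' := smul_right_injective _ (gpos s hs).ne' e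
    rw [e']
    abel
end

section
/- (Proposition 6, deterministic part: generalized fractional Hamilton equations.) Let L : ℝ × ℝⁿ × ℝⁿ → ℝ be C¹ and let V : ℝ × ℝⁿ × ℝⁿ → ℝⁿ be differentiable with ∇_v L(s,q,V(s,q,p)) = p for all (s,q,p); set H(s,q,p) = ⟨p, V(s,q,p)⟩ − L(s,q,V(s,q,p)). Let α : ℝ → ℝ be differentiable, ρ ∈ ℝ, t ∈ ℝ, and let (q,p) : [a,b] → ℝⁿ × ℝⁿ be C¹ with t ∉ [a,b] and α(s−t) > 0 on [a,b]; define v(s) = V(s,q(s),p(s)). Then the generalized fractional HP equations (q' = v, p'(s) = ∇_q L(s,q(s),v(s)) − h(s,t)·p(s), p(s) = ∇_v L(s,q(s),v(s))) hold on [a,b] if and only if the generalized fractional Hamilton equations q'(s) = ∇_p H(s,q(s),p(s)) and p'(s) = −∇_q H(s,q(s),p(s)) − h(s,t)·p(s) hold on [a,b]. -/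
open RealInnerProductSpace

theorem gradY {E : Type*} [NormedAddCommGroup E] [InnerProductSpace ℝ E] [CompleteSpace E]
    (W : E → E) (l : E → ℝ) (y : E) (hW : DifferentiableAt ℝ W y)
    (hl : DifferentiableAt ℝ l (W y)) (hg : gradient l (W y) = y) :
    gradient (fun y => ⟪y, W y⟫ - l (W y)) y = W y := by
  apply HasGradientAt.gradient
  rw [hasGradientAt_iff_hasFDerivAt]
  have h1 := (hasFDerivAt_id (𝕜 := ℝ) y).inner ℝ hW.hasFDerivAt
  have h0 := hl.hasGradientAt.hasFDerivAt
  rw [hg] at h0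
  have h2 := h0.comp y hW.hasFDerivAt
  refine (h1.sub h2).congr_fderiv ?_
  ext d
  simp [fderivInnerCLM_apply, real_inner_comm]

theorem gradX {E : Type*} [NormedAddCommGroup E] [InnerProductSpace ℝ E] [CompleteSpace E]
    (W : E → E) (l : E × E → ℝ) (x y : E) (hW : DifferentiableAt ℝ W x)
    (hl : DifferentiableAt ℝ l (x, W x)) (hg : gradient (fun w => l (x, w)) (W x) = y) :
    gradient (fun x => ⟪y, W x⟫ - l (x, W x)) x = - gradient (fun z => l (z, W x)) x := by
  have hz : HasFDerivAt (fun z => l (z, W x)) ((fderiv ℝ l (x, W x)).comp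
      (ContinuousLinearMap.inl ℝ E E)) x :=
    HasFDerivAt.comp x hl.hasFDerivAt (hasFDerivAt_prodMk_left x (W x))
  have hw : HasFDerivAt (fun w => l (x, w)) ((fderiv ℝ l (x, W x)).comp
      (ContinuousLinearMap.inr ℝ E E)) (W x) :=
    HasFDerivAt.comp (W x) hl.hasFDerivAt (hasFDerivAt_prodMk_right x (W x))
  have hz' := hz.unique hz.differentiableAt.hasGradientAt.hasFDerivAt
  have hw' := hw.unique hw.differentiableAt.hasGradientAt.hasFDerivAt
  rw [hg] at hw'
  apply HasGradientAt.gradient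
  rw [hasGradientAt_iff_hasFDerivAt]
  have h1 := (hasFDerivAt_const (𝕜 := ℝ) y x).inner ℝ hW.hasFDerivAt
  have h2 : HasFDerivAt (fun x => l (x, W x)) _ x :=
    HasFDerivAt.comp x hl.hasFDerivAt ((hasFDerivAt_id (𝕜 := ℝ) x).prodMk hW.hasFDerivAt)
  refine (h1.sub h2).congr_fderiv ?_
  ext d
  have e1 := DFunLike.congr_fun hz' d
  have e2 := DFunLike.congr_fun hw' (fderiv ℝ W x d)
  have e3 : fderiv ℝ l (x, W x) (d, fderiv ℝ W x d) =
      fderiv ℝ l (x, W x) (d, 0) + fderiv ℝ l (x, W x) (0, fderiv ℝ W x d) := by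
    rw [← map_add]; simp
  simp at e1 e2
  simp [fderivInnerCLM_apply, e3, e1, e2]

/-- Proposition 6 (deterministic part): for a `C¹` Lagrangian `L` with differentiable
inverse Legendre map `V` and Hamiltonian `H(s,q,p) = ⟨p, V(s,q,p)⟩ − L(s,q,V(s,q,p))`,
a `C¹` curve `(q,p)` with `v(s) = V(s,q(s),p(s))` satisfies the generalized fractional HP
equations on `[a,b]` iff it satisfies the generalized fractional Hamilton equations
`q' = ∇_p H`, `p' = −∇_q H − h(s,t)·p`. -/
theorem statement7 (n : ℕ) (a b : ℝ) (hab : a < b)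
    (α : ℝ → ℝ) (hα : Differentiable ℝ α) (ρ t : ℝ)
    (ht : t ∉ Set.Icc a b) (hαpos : ∀ s ∈ Set.Icc a b, 0 < α (s - t))
    (L : ℝ → EuclideanSpace ℝ (Fin n) → EuclideanSpace ℝ (Fin n) → ℝ)
    (hL : ContDiff ℝ 1 (fun x : ℝ × EuclideanSpace ℝ (Fin n) × EuclideanSpace ℝ (Fin n) =>
      L x.1 x.2.1 x.2.2))
    (V : ℝ → EuclideanSpace ℝ (Fin n) → EuclideanSpace ℝ (Fin n) → EuclideanSpace ℝ (Fin n))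
    (hV : Differentiable ℝ (fun x : ℝ × EuclideanSpace ℝ (Fin n) × EuclideanSpace ℝ (Fin n) =>
      V x.1 x.2.1 x.2.2))
    (hLeg : ∀ s x y, gradient (fun w => L s x w) (V s x y) = y)
    (H : ℝ → EuclideanSpace ℝ (Fin n) → EuclideanSpace ℝ (Fin n) → ℝ)
    (hH : ∀ s x y, H s x y = ⟪y, V s x y⟫ - L s x (V s x y))
    (q p q' p' v : ℝ → EuclideanSpace ℝ (Fin n))
    (hq : ContDiffOn ℝ 1 q (Set.Icc a b))
    (hp : ContDiffOn ℝ 1 p (Set.Icc a b))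
    (hq' : ∀ s ∈ Set.Icc a b, HasDerivWithinAt q (q' s) (Set.Icc a b) s)
    (hp' : ∀ s ∈ Set.Icc a b, HasDerivWithinAt p (p' s) (Set.Icc a b) s)
    (hv : ∀ s, v s = V s (q s) (p s)) :
    (∀ s ∈ Set.Icc a b,
        q' s = v s ∧
        p' s = gradient (fun x => L s x (v s)) (q s) - hwt t ρ α s • p s ∧
        p s = gradient (fun w => L s (q s) w) (v s))
      ↔
    (∀ s ∈ Set.Icc a b,
        q' s = gradient (fun y => H s (q s) y) (p s) ∧
        p' s = - gradient (fun x => H s x (p s)) (q s) - hwt t ρ α s • p s) := by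
  have hLd := hL.differentiable (by norm_num)
  have hY : ∀ s, gradient (fun y => H s (q s) y) (p s) = v s := by
    intro s
    rw [hv]
    simp only [hH]
    refine gradY (fun y => V s (q s) y) (fun w => L s (q s) w) (p s) ?_ ?_ (hLeg _ _ _)
    · exact (hV.comp (g := fun x => V x.1 x.2.1 x.2.2) (f := fun y => (s, q s, y))
        (by fun_prop)).differentiableAt
    · exact (hLd.comp (g := fun x => L x.1 x.2.1 x.2.2) (f := fun y => (s, q s, y))
        (by fun_prop)).differentiableAt
  have hX : ∀ s, gradient (fun x => H s x (p s)) (q s)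
      = - gradient (fun x => L s x (v s)) (q s) := by
    intro s
    rw [hv]
    simp only [hH]
    refine gradX (fun x => V s x (p s)) (fun z => L s z.1 z.2) (q s) (p s) ?_ ?_ (hLeg _ _ _)
    · exact (hV.comp (g := fun x => V x.1 x.2.1 x.2.2) (f := fun y => (s, y, p s))
        (by fun_prop)).differentiableAt
    · exact (hLd.comp (g := fun x => L x.1 x.2.1 x.2.2)
        (f := fun z : EuclideanSpace ℝ (Fin n) × EuclideanSpace ℝ (Fin n) => (s, z.1, z.2))
        (by fun_prop)).differentiableAt
  have hP : ∀ s, p s = gradient (fun w => L s (q s) w) (v s) := by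
    intro s
    rw [hv, hLeg]
  refine forall₂_congr fun s _ => ?_
  rw [hY, hX, neg_neg]
  exact ⟨fun h => ⟨h.1, h.2.1⟩, fun h => ⟨h.1, h.2, hP s⟩⟩
end

section
/- (Proposition 7, deterministic part: generalized fractional geodesic equations.) Let g : ℝⁿ → Mat(n,n;ℝ) be a C¹ field of symmetric invertible matrices, let α : ℝ → ℝ be differentiable, ρ ∈ ℝ, t ∈ ℝ, and let q : [a,b] → ℝⁿ be of class C² with t ∉ [a,b] and α(s−t) > 0 on [a,b]. Set v = q' and p_i(s) = Σ_j g_{ij}(q(s)) v^j(s). Then p satisfies the generalized fractional HP momentum equation p_i'(s) = ½ Σ_{k,l} (∂g_{kl}/∂x^i)(q(s)) v^k(s) v^l(s) − h(s,t)·p_i(s) for all i and s ∈ [a,b] if and only if q''^i(s) = −Σ_{j,k} Γ^i_{jk}(q(s)) q'^j(s) q'^k(s) − h(s,t)·q'^i(s) for all i and s ∈ [a,b]. -/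
lemma aux_alg (n : ℕ) (G : Matrix (Fin n) (Fin n) ℝ) (hG : IsUnit G)
    (D : Fin n → Fin n → Fin n → ℝ) (v w : Fin n → ℝ) (H : ℝ) :
    (∀ i, ∑ j, ((∑ m, v m * D m i j) * v j + G i j * w j)
        = (1 / 2) * ∑ k, ∑ l, D i k l * v k * v l - H * ∑ j, G i j * v j) ↔
    (∀ i, w i = - (∑ j, ∑ k, ((1 / 2) * ∑ l, G⁻¹ i l * (D j l k + D k l j - D l j k)) * v j * v k)
        - H * v i) := by
  have hdet : IsUnit G.det := (Matrix.isUnit_iff_isUnit_det G).1 hG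
  set c : Fin n → ℝ := fun l => ∑ j, (∑ m, v m * D m l j) * v j
    - (1 / 2) * ∑ k, ∑ m, D l k m * v k * v m with hc
  have hcl : ∀ l, c l = (1 / 2) * ∑ j, ∑ k, (D j l k + D k l j - D l j k) * v j * v k := by
    intro l
    have e1 : ∑ j, (∑ m, v m * D m l j) * v j = ∑ j, ∑ k, D k l j * v j * v k := by
      refine Finset.sum_congr rfl fun j _ => ?_
      rw [Finset.sum_mul]
      exact Finset.sum_congr rfl fun k _ => by ring
    have e2 : ∑ j, ∑ k, D j l k * v j * v k = ∑ j, ∑ k, D k l j * v j * v k := by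
      rw [Finset.sum_comm]
      exact Finset.sum_congr rfl fun j _ => Finset.sum_congr rfl fun k _ => by ring
    simp only [hc, e1, sub_mul, add_mul, Finset.sum_add_distrib, Finset.sum_sub_distrib, e2]
    ring
  have hΓ : ∀ i, ∑ j, ∑ k, ((1 / 2) * ∑ l, G⁻¹ i l * (D j l k + D k l j - D l j k)) * v j * v k
      = (G⁻¹.mulVec c) i := by
    intro i
    simp only [Matrix.mulVec, dotProduct, hcl, Finset.mul_sum, Finset.sum_mul]
    symm
    rw [Finset.sum_comm]
    refine Finset.sum_congr rfl fun j _ => ?_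
    rw [Finset.sum_comm]
    exact Finset.sum_congr rfl fun k _ => Finset.sum_congr rfl fun l _ => by ring
  have hA : (∀ i, ∑ j, ((∑ m, v m * D m i j) * v j + G i j * w j)
        = (1 / 2) * ∑ k, ∑ l, D i k l * v k * v l - H * ∑ j, G i j * v j) ↔
      G.mulVec w = - c - H • G.mulVec v := by
    rw [funext_iff]
    refine forall_congr' fun i => ?_
    simp only [Finset.sum_add_distrib, Pi.sub_apply, Pi.neg_apply, Pi.smul_apply, smul_eq_mul,
      Matrix.mulVec, dotProduct, hc]
    constructor <;> intro h <;> linarith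
  have hB : (∀ i, w i = - (∑ j, ∑ k, ((1 / 2) * ∑ l, G⁻¹ i l *
      (D j l k + D k l j - D l j k)) * v j * v k) - H * v i) ↔
      w = - G⁻¹.mulVec c - H • v := by
    rw [funext_iff]
    refine forall_congr' fun i => ?_
    rw [hΓ]
    simp
  rw [hA, hB]
  constructor
  · intro h
    have := congrArg (G⁻¹.mulVec) h
    simpa [Matrix.mulVec_sub, Matrix.mulVec_neg, Matrix.mulVec_smul, Matrix.mulVec_mulVec,
      Matrix.nonsing_inv_mul _ hdet] using this
  · rintro h
    rw [h]
    simp [Matrix.mulVec_sub, Matrix.mulVec_neg, Matrix.mulVec_smul, Matrix.mulVec_mulVec,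
      Matrix.mul_nonsing_inv _ hdet]

/-- Proposition 7 (deterministic part): for the kinetic-energy Lagrangian of a `C¹`
Riemannian metric `g` on `ℝⁿ` and a `C²` curve `q` with `v = q'` and momentum
`p_i = Σ_j g_{ij}(q) v^j`, the generalized fractional HP momentum equations
`p_i' = ½ Σ_{k,l} ∂g_{kl}/∂x^i(q) v^k v^l − h(s,t) p_i` hold on `[a,b]` iff `q` satisfies
the generalized fractional geodesic equations
`q''^i = −Σ_{j,k} Γ^i_{jk}(q) q'^j q'^k − h(s,t) q'^i`. -/
theorem statement13 (n : ℕ) (a b : ℝ) (hab : a < b)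
    (α : ℝ → ℝ) (hα : Differentiable ℝ α) (ρ t : ℝ)
    (ht : t ∉ Set.Icc a b) (hαpos : ∀ s ∈ Set.Icc a b, 0 < α (s - t))
    (g : EuclideanSpace ℝ (Fin n) → Matrix (Fin n) (Fin n) ℝ)
    (hg : ∀ i j, ContDiff ℝ 1 (fun x => g x i j))
    (hsym : ∀ x, (g x).IsSymm)
    (hinv : ∀ x, IsUnit (g x))
    (q q' q'' : ℝ → EuclideanSpace ℝ (Fin n))
    (hq : ContDiffOn ℝ 2 q (Set.Icc a b))
    (hq' : ∀ s ∈ Set.Icc a b, HasDerivWithinAt q (q' s) (Set.Icc a b) s)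
    (hq'' : ∀ s ∈ Set.Icc a b, HasDerivWithinAt q' (q'' s) (Set.Icc a b) s)
    (Dg : Fin n → Fin n → Fin n → EuclideanSpace ℝ (Fin n) → ℝ)
    (hDg : ∀ i k l x, Dg i k l x = fderiv ℝ (fun y => g y k l) x (EuclideanSpace.single i 1))
    (Γ : Fin n → Fin n → Fin n → EuclideanSpace ℝ (Fin n) → ℝ)
    (hΓ : ∀ i j k x,
      Γ i j k x = (1 / 2) * ∑ l, (g x)⁻¹ i l * (Dg j l k x + Dg k l j x - Dg l j k x)) :
    (∀ i, ∀ s ∈ Set.Icc a b,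
        HasDerivWithinAt (fun u => ∑ j, g (q u) i j * q' u j)
          ((1 / 2) * ∑ k, ∑ l, Dg i k l (q s) * q' s k * q' s l
            - hwt t ρ α s * ∑ j, g (q s) i j * q' s j) (Set.Icc a b) s)
      ↔
    (∀ i, ∀ s ∈ Set.Icc a b,
        q'' s i = - (∑ j, ∑ k, Γ i j k (q s) * q' s j * q' s k) - hwt t ρ α s * q' s i) := by
  have key : ∀ i, ∀ s ∈ Set.Icc a b,
      HasDerivWithinAt (fun u => ∑ j, g (q u) i j * q' u j)
        (∑ j, ((∑ m, q' s m * Dg m i j (q s)) * q' s j + g (q s) i j * q'' s j))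
        (Set.Icc a b) s := by
    intro i s hs
    refine HasDerivWithinAt.fun_sum fun j _ => ?_
    have h1 : HasDerivWithinAt (fun u => g (q u) i j)
        (fderiv ℝ (fun y => g y i j) (q s) (q' s)) (Set.Icc a b) s :=
      (((hg i j).differentiable one_ne_zero (q s)).hasFDerivAt).comp_hasDerivWithinAt s (hq' s hs)
    have h2 : HasDerivWithinAt (fun u => q' u j) (q'' s j) (Set.Icc a b) s :=
      ((EuclideanSpace.proj (𝕜 := ℝ) j).hasFDerivAt).comp_hasDerivWithinAt s (hq'' s hs)
    have h3 : fderiv ℝ (fun y => g y i j) (q s) (q' s) = ∑ m, q' s m * Dg m i j (q s) := by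
      have hv : q' s = ∑ m, q' s m • EuclideanSpace.single m (1 : ℝ) := by
        ext k
        simp [Finset.sum_apply, Pi.single_apply]
      conv_lhs => rw [hv]
      simp [map_sum, hDg]
    rw [← h3]
    exact h1.mul h2
  have huniq : ∀ s ∈ Set.Icc a b, UniqueDiffWithinAt ℝ (Set.Icc a b) s :=
    fun s hs => uniqueDiffOn_Icc hab s hs
  have alg := fun s => aux_alg n (g (q s)) (hinv _) (fun i k l => Dg i k l (q s))
    (fun i => q' s i) (fun i => q'' s i) (hwt t ρ α s)
  simp only [hΓ]
  constructor
  · intro h i s hs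
    exact (alg s).1 (fun i => (huniq s hs).eq_deriv _ (key i s hs) (h i s hs)) i
  · intro h i s hs
    have := (alg s).2 (fun i => h i s hs) i
    exact this ▸ key i s hs
end
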